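/- For every α ≥ 1 there exists a constant γ = γ(α) > 0 such that every n-dimensional centrally symmetric polytope P ⊂ ℝⁿ with at most αn vertices has at least 2^(γn) facets. -/

import Mathlib

open scoped RealInnerProductSpace

/-- `F` is a face of `P ⊆ ℝⁿ`: the (nonempty) intersection of `P` with a supporting
affine hyperplane. -/
def IsFaceOf {n : ℕ} (P F : Set (EuclideanSpace ℝ (Fin n))) : Prop :=
  F.Nonempty ∧ ∃ (c : EuclideanSpace ℝ (Fin n)) (b : ℝ), c ≠ 0 ∧
    (∀ x ∈ P, ⟪x, c⟫ ≤ b) ∧ F = P ∩ {x | ⟪x, c⟫ = b}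

/-- `F` is a facet of `P ⊆ ℝⁿ`: a face of codimension `1`, i.e. of dimension `n - 1`. -/
def IsFacetOf {n : ℕ} (P F : Set (EuclideanSpace ℝ (Fin n))) : Prop :=
  IsFaceOf P F ∧ Module.finrank ℝ (affineSpan ℝ F).direction = n - 1

open MeasureTheory

lemma integral_Icc_exp_mul_le {K : ℝ} (hK : 0 ≤ K) (s : ℝ) :
    ∫ x in Set.Icc (-K) K, Real.exp (s * x) ≤ 2 * K * Real.exp (s ^ 2 * K ^ 2 / 2) := by
  have hle : -K ≤ K := by linarith
  have hneg : ∫ x in (-K)..K, Real.exp (s * x) = ∫ x in (-K)..K, Real.exp (-(s * x)) := by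
    have := intervalIntegral.integral_comp_neg (a := -K) (b := K) (fun x => Real.exp (s * x))
    simpa using this.symm
  have hcosh : ∫ x in (-K)..K, Real.exp (s * x) = ∫ x in (-K)..K, Real.cosh (s * x) := by
    have hadd : ∫ x in (-K)..K, Real.cosh (s * x) =
        ((∫ x in (-K)..K, Real.exp (s * x)) + ∫ x in (-K)..K, Real.exp (-(s * x))) / 2 := by
      rw [← intervalIntegral.integral_add, ← intervalIntegral.integral_div]
      · simp [Real.cosh_eq]
      all_goals exact Continuous.intervalIntegrable (by fun_prop) _ _
    rw [hadd, ← hneg]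
    ring
  rw [integral_Icc_eq_integral_Ioc, ← intervalIntegral.integral_of_le hle, hcosh]
  calc ∫ x in (-K)..K, Real.cosh (s * x)
      ≤ ∫ _ in (-K)..K, Real.exp (s ^ 2 * K ^ 2 / 2) := by
        refine intervalIntegral.integral_mono_on hle
          (Continuous.intervalIntegrable (by fun_prop) _ _)
          (Continuous.intervalIntegrable (by fun_prop) _ _) fun x hx => ?_
        refine (Real.cosh_le_exp_half_sq _).trans (Real.exp_le_exp.2 ?_)
        have : x ^ 2 ≤ K ^ 2 := sq_le_sq' hx.1 hx.2
        rw [mul_pow]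
        gcongr
    _ = 2 * K * Real.exp (s ^ 2 * K ^ 2 / 2) := by
        rw [intervalIntegral.integral_const, smul_eq_mul]
        ring

/-- The Chernoff bound for a linear form with coefficients in `[-1, 1]` on the cube `[-K, K]ⁿ`. -/
lemma measureReal_cube_linear_ge_le {n : ℕ} {K : ℝ} (hK : 0 < K) {a : Fin n → ℝ}
    (ha : ∀ i, |a i| ≤ 1) :
    (volume.restrict (Set.univ.pi fun _ : Fin n => Set.Icc (-K) K)).real
        {g | (n : ℝ) ≤ ∑ i, a i * g i} ≤
      (2 * K) ^ n * Real.exp (-(n / (2 * K ^ 2))) := by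
  have hμ : (volume.restrict (Set.univ.pi fun _ : Fin n => Set.Icc (-K) K)) =
      Measure.pi fun _ : Fin n => volume.restrict (Set.Icc (-K) K) := by
    rw [volume_pi, Measure.restrict_pi_pi]
  set l : ℝ := 1 / K ^ 2 with hl
  have hl0 : 0 < l := by positivity
  have hexp : ∀ g : Fin n → ℝ,
      Real.exp (l * ∑ i, a i * g i) = ∏ i, Real.exp (l * a i * g i) := fun g => by
    rw [← Real.exp_sum, Finset.mul_sum]
    simp only [mul_assoc]
  have hint : ∫ g, Real.exp (l * ∑ i, a i * g i)
      ∂(volume.restrict (Set.univ.pi fun _ : Fin n => Set.Icc (-K) K)) ≤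
        (2 * K * Real.exp (l / 2)) ^ n := by
    rw [hμ]
    simp_rw [hexp]
    rw [integral_fintype_prod_eq_prod (fun i x => Real.exp (l * a i * x))]
    calc ∏ i, ∫ x in Set.Icc (-K) K, Real.exp (l * a i * x)
        ≤ ∏ _i : Fin n, (2 * K * Real.exp (l / 2)) := by
          refine Finset.prod_le_prod (fun i _ => integral_nonneg fun x => (Real.exp_pos _).le)
            fun i _ => (integral_Icc_exp_mul_le hK.le _).trans ?_
          gcongr
          have h1 : a i ^ 2 ≤ 1 := (sq_le_one_iff_abs_le_one _).2 (ha i)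
          calc (l * a i) ^ 2 * K ^ 2 = l * a i ^ 2 := by
                rw [hl]; field_simp
            _ ≤ l := mul_le_of_le_one_right hl0.le h1
      _ = _ := by simp
  have hI : Integrable (fun g : Fin n → ℝ => Real.exp (l * ∑ i, a i * g i))
      (volume.restrict (Set.univ.pi fun _ : Fin n => Set.Icc (-K) K)) :=
    ContinuousOn.integrableOn_compact (isCompact_univ_pi fun _ => isCompact_Icc)
      (Continuous.continuousOn (by fun_prop))
  have hM := mul_meas_ge_le_integral_of_nonneg
    (Filter.Eventually.of_forall fun g => (Real.exp_pos _).le) hI (Real.exp (l * n))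
  have hset : {g : Fin n → ℝ | Real.exp (l * n) ≤ Real.exp (l * ∑ i, a i * g i)} =
      {g | (n : ℝ) ≤ ∑ i, a i * g i} := by
    ext g
    simp [hl0]
  rw [hset] at hM
  have h3 := hM.trans hint
  rw [mul_pow, ← Real.exp_nat_mul] at h3
  rw [← mul_le_mul_iff_right₀ (Real.exp_pos (l * n))]
  refine h3.trans_eq ?_
  rw [mul_left_comm, ← Real.exp_add]
  congr 2
  rw [hl]
  field_simp
  ring

/-- A linear map of determinant at most one maps the cross-polytope of radius `n` in `ℝⁿ` to a
set of volume at most `(2e)ⁿ`. -/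
lemma volume_image_l1Ball_le {n : ℕ} (hn : n ≠ 0) (f : (Fin n → ℝ) →ₗ[ℝ] Fin n → ℝ)
    (hf : |LinearMap.det f| ≤ 1) :
    volume (f '' {x | ∑ i, |x i| ≤ n}) ≤ ENNReal.ofReal ((2 * Real.exp 1) ^ n) := by
  have : Nonempty (Fin n) := ⟨⟨0, Nat.pos_of_ne_zero hn⟩⟩
  have hball : volume {x : Fin n → ℝ | ∑ i, |x i| ≤ n} ≤
      ENNReal.ofReal ((2 * Real.exp 1) ^ n) := by
    have h := volume_sum_rpow_le (Fin n) le_rfl (n : ℝ)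
    simp only [Real.rpow_one, div_one, Fintype.card_fin, Real.Gamma_nat_eq_factorial,
      one_add_one_eq_two, Real.Gamma_two, mul_one] at h
    rw [h, ← ENNReal.ofReal_pow (by positivity), ← ENNReal.ofReal_mul (by positivity)]
    refine ENNReal.ofReal_le_ofReal ?_
    have := Real.pow_div_factorial_le_exp n n.cast_nonneg n
    rw [mul_pow, ← Real.exp_nat_mul, mul_one]
    calc (n : ℝ) ^ n * (2 ^ n / n.factorial) = 2 ^ n * ((n : ℝ) ^ n / n.factorial) := by ring
      _ ≤ _ := by gcongr
  rw [Measure.addHaar_image_linearMap]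
  exact (mul_le_of_le_one_left' (ENNReal.ofReal_le_one.2 hf)).trans hball

section Polar

variable {E : Type*} [NormedAddCommGroup E] [InnerProductSpace ℝ E]

/-- The polar body of a finite set of points. -/
def polarBody (S : Finset E) : Set E := {c | ∀ s ∈ S, ⟪s, c⟫ ≤ 1}

lemma inner_le_of_mem_convexHull {S : Finset E} {c x : E} {b : ℝ} (hc : ∀ s ∈ S, ⟪s, c⟫ ≤ b)
    (hx : x ∈ convexHull ℝ (S : Set E)) : ⟪x, c⟫ ≤ b := by
  have hconv : Convex ℝ {y : E | ⟪y, c⟫ ≤ b} :=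
    convex_halfSpace_le ⟨fun x y => inner_add_left x y c, fun r x => real_inner_smul_left x c r⟩ b
  exact convexHull_min (fun s hs => hc s hs) hconv hx

lemma convex_polarBody (S : Finset E) : Convex ℝ (polarBody S) := by
  have : polarBody S = ⋂ s ∈ S, {c | ⟪s, c⟫ ≤ 1} := by
    ext
    simp [polarBody]
  rw [this]
  exact convex_iInter₂ fun s _ =>
    convex_halfSpace_le ⟨fun x y => inner_add_right s x y, fun r x => real_inner_smul_right s x r⟩ 1

lemma isClosed_polarBody (S : Finset E) : IsClosed (polarBody S) := by
  have : polarBody S = ⋂ s ∈ S, {c | ⟪s, c⟫ ≤ 1} := by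
    ext
    simp [polarBody]
  rw [this]
  exact isClosed_biInter fun s _ => isClosed_le (by fun_prop) (by fun_prop)

variable [FiniteDimensional ℝ E]

lemma isCompact_polarBody {S : Finset E} (h0 : (0 : E) ∈ interior (convexHull ℝ (S : Set E))) :
    IsCompact (polarBody S) := by
  obtain ⟨ε, hε, hball⟩ := Metric.isOpen_iff.1 isOpen_interior 0 h0
  refine Metric.isCompact_of_isClosed_isBounded (isClosed_polarBody S)
    (isBounded_iff_forall_norm_le.2 ⟨2 / ε, fun c hc => ?_⟩)
  rcases eq_or_ne c 0 with rfl | hc0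
  · simpa using by positivity
  have hpos : 0 < ‖c‖ := norm_pos_iff.2 hc0
  have hmem : (ε / 2 / ‖c‖) • c ∈ Metric.ball (0 : E) ε := by
    rw [mem_ball_zero_iff, norm_smul, Real.norm_of_nonneg (by positivity)]
    field_simp
    linarith
  have h := inner_le_of_mem_convexHull hc (interior_subset (hball hmem))
  rw [real_inner_smul_left, real_inner_self_eq_norm_sq] at h
  rw [le_div_iff₀ hε]
  field_simp at h
  linarith

lemma exists_mem_polarBody_one_lt_inner {S : Finset E}
    (h0 : (0 : E) ∈ convexHull ℝ (S : Set E)) {x : E}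
    (hx : x ∉ convexHull ℝ (S : Set E)) : ∃ c ∈ polarBody S, 1 < ⟪x, c⟫ := by
  obtain ⟨f, u, hfu, hux⟩ := geometric_hahn_banach_closed_point (convex_convexHull ℝ (S : Set E))
    (S.finite_toSet.isClosed_convexHull ℝ) hx
  have hu : 0 < u := by simpa using hfu 0 h0
  set d := (InnerProductSpace.toDual ℝ E).symm f
  have hd : ∀ y, ⟪y, d⟫ = f y := fun y => by
    rw [real_inner_comm, InnerProductSpace.toDual_symm_apply]
  refine ⟨u⁻¹ • d, fun s hs => ?_, ?_⟩
  · rw [real_inner_smul_right, hd, inv_mul_le_iff₀ hu, mul_one]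
    exact (hfu s (subset_convexHull ℝ _ hs)).le
  · rwa [real_inner_smul_right, hd, lt_inv_mul_iff₀ hu, mul_one]

/-- A point outside a polytope violates the inequality of a vertex of the polar body. -/
lemma exists_extremePoint_polarBody_one_lt_inner {S : Finset E}
    (h0 : (0 : E) ∈ interior (convexHull ℝ (S : Set E))) {x : E}
    (hx : x ∉ convexHull ℝ (S : Set E)) :
    ∃ c ∈ (polarBody S).extremePoints ℝ, 1 < ⟪x, c⟫ := by
  by_contra! h
  obtain ⟨c, hc, hxc⟩ := exists_mem_polarBody_one_lt_inner (interior_subset h0) hx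
  have hconv : Convex ℝ {c : E | ⟪x, c⟫ ≤ 1} :=
    convex_halfSpace_le ⟨fun y z => inner_add_right x y z, fun r y => real_inner_smul_right x y r⟩ 1
  have hclosed : IsClosed {c : E | ⟪x, c⟫ ≤ 1} := isClosed_le (by fun_prop) (by fun_prop)
  rw [← closure_convexHull_extremePoints (isCompact_polarBody h0) (convex_polarBody S)] at hc
  exact hxc.not_ge (closure_minimal (convexHull_min h hconv) hclosed hc)

lemma span_active_eq_top {S : Finset E} {c : E} (hc : c ∈ (polarBody S).extremePoints ℝ) :
    Submodule.span ℝ {s : E | s ∈ S ∧ ⟪s, c⟫ = 1} = ⊤ := by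
  by_contra hne
  obtain ⟨d, hd, hd0⟩ := Submodule.exists_mem_ne_zero_of_ne_bot
    (mt Submodule.orthogonal_eq_bot_iff.1 hne)
  have hact : ∀ s ∈ S, ⟪s, c⟫ = 1 → ⟪s, d⟫ = 0 := fun s hs hsc =>
    Submodule.inner_right_of_mem_orthogonal
      (Submodule.subset_span (s := {s : E | s ∈ S ∧ ⟪s, c⟫ = 1}) ⟨hs, hsc⟩) hd
  have hev : ∀ᶠ t : ℝ in nhds 0, ∀ s ∈ S, ⟪s, c + t • d⟫ ≤ 1 := by
    rw [Filter.eventually_all_finset]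
    intro s hs
    rcases (hc.1 s hs).eq_or_lt with h1 | h1
    · refine Filter.Eventually.of_forall fun t => ?_
      rw [inner_add_right, real_inner_smul_right, hact s hs h1, h1]
      simp
    · have hcont : Continuous fun t : ℝ => ⟪s, c + t • d⟫ := by fun_prop
      have : ∀ᶠ t : ℝ in nhds 0, ⟪s, c + t • d⟫ < 1 :=
        hcont.continuousAt.eventually_lt continuousAt_const (by simpa using h1)
      exact this.mono fun t ht => ht.le
  obtain ⟨ε, hε, hball⟩ := Metric.eventually_nhds_iff.1 hev
  have hp : c + (ε / 2) • d ∈ polarBody S := hball (by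
    rw [dist_zero_right, Real.norm_of_nonneg (by positivity)]; linarith)
  have hm : c + (-(ε / 2)) • d ∈ polarBody S := hball (by
    rw [dist_zero_right, norm_neg, Real.norm_of_nonneg (by positivity)]; linarith)
  have hmid : c ∈ openSegment ℝ (c + (ε / 2) • d) (c + (-(ε / 2)) • d) :=
    ⟨1 / 2, 1 / 2, by norm_num, by norm_num, by norm_num, by module⟩
  have h := hc.2 hp hm hmid
  rw [add_eq_left, smul_eq_zero] at h
  exact h.elim (by positivity) hd0

end Polar

section Facets

variable {n : ℕ}

lemma isFacetOf_of_mem_extremePoints (hn : n ≠ 0) {S : Finset (EuclideanSpace ℝ (Fin n))}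
    {c : EuclideanSpace ℝ (Fin n)} (hc : c ∈ (polarBody S).extremePoints ℝ) :
    IsFacetOf (convexHull ℝ (S : Set (EuclideanSpace ℝ (Fin n))))
      (convexHull ℝ (S : Set (EuclideanSpace ℝ (Fin n))) ∩ {x | ⟪x, c⟫ = 1}) := by
  set F := convexHull ℝ (S : Set (EuclideanSpace ℝ (Fin n))) ∩ {x | ⟪x, c⟫ = 1} with hF
  have hfin : Module.finrank ℝ (EuclideanSpace ℝ (Fin n)) = n := by simp
  have : Nontrivial (EuclideanSpace ℝ (Fin n)) :=
    Module.nontrivial_of_finrank_pos (R := ℝ) (by rw [hfin]; exact Nat.pos_of_ne_zero hn)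
  have hspan := span_active_eq_top hc
  have hsub : {s | s ∈ S ∧ ⟪s, c⟫ = 1} ⊆ F := fun s hs => ⟨subset_convexHull ℝ _ hs.1, hs.2⟩
  obtain ⟨s₀, hs₀⟩ : {s | s ∈ S ∧ ⟪s, c⟫ = 1}.Nonempty := by
    rw [Set.nonempty_iff_ne_empty]
    intro h
    rw [h, Submodule.span_empty] at hspan
    exact bot_ne_top hspan
  have hc0 : c ≠ 0 := by
    rintro rfl
    simpa using hs₀.2
  refine ⟨⟨⟨s₀, hsub hs₀⟩, c, 1, hc0, fun x hx => inner_le_of_mem_convexHull hc.1 hx, hF⟩, ?_⟩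
  rw [direction_affineSpan]
  apply le_antisymm
  · have hle : vectorSpan ℝ F ≤ (Submodule.span ℝ {c})ᗮ := by
      rw [vectorSpan_def, Submodule.span_le]
      rintro _ ⟨x, hx, y, hy, rfl⟩
      change x - y ∈ (Submodule.span ℝ {c})ᗮ
      rw [Submodule.mem_orthogonal_singleton_iff_inner_left, inner_sub_left, hx.2, hy.2, sub_self]
    have h1 := Submodule.finrank_mono hle
    have h2 := Submodule.finrank_add_finrank_orthogonal (Submodule.span ℝ {c})
    rw [finrank_span_singleton hc0, hfin] at h2
    omega
  · have htop : vectorSpan ℝ F ⊔ Submodule.span ℝ {s₀} = ⊤ := by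
      rw [eq_top_iff, ← hspan, Submodule.span_le]
      intro s hs
      rw [← sub_add_cancel s s₀]
      exact Submodule.add_mem_sup (vsub_mem_vectorSpan ℝ (hsub hs) (hsub hs₀))
        (Submodule.mem_span_singleton_self s₀)
    have h1 := Submodule.finrank_add_le_finrank_add_finrank (vectorSpan ℝ F)
      (Submodule.span ℝ {s₀})
    rw [htop, finrank_top, hfin] at h1
    have h2 : Module.finrank ℝ (Submodule.span ℝ {s₀}) ≤ 1 := by
      simpa using finrank_span_le_card (R := ℝ) ({s₀} : Set (EuclideanSpace ℝ (Fin n)))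
    omega

lemma finite_setOf_isFacetOf (S : Finset (EuclideanSpace ℝ (Fin n))) :
    {F | IsFacetOf (convexHull ℝ (S : Set (EuclideanSpace ℝ (Fin n)))) F}.Finite := by
  refine Set.Finite.of_finite_image (f := fun F => F ∩ (S : Set (EuclideanSpace ℝ (Fin n))))
    (S.finite_toSet.finite_subsets.subset ?_) ?_
  · rintro _ ⟨F, -, rfl⟩
    exact Set.inter_subset_right
  · have key : ∀ F, IsFacetOf (convexHull ℝ (S : Set (EuclideanSpace ℝ (Fin n)))) F →
        F = convexHull ℝ (F ∩ (S : Set (EuclideanSpace ℝ (Fin n)))) := by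
      rintro F ⟨⟨hne, c, b, -, hle, hF⟩, -⟩
      have hP : IsCompact (convexHull ℝ (S : Set (EuclideanSpace ℝ (Fin n)))) :=
        S.finite_toSet.isCompact_convexHull ℝ
      obtain ⟨z, hz⟩ := hne
      have hexp : IsExposed ℝ (convexHull ℝ (S : Set (EuclideanSpace ℝ (Fin n)))) F := by
        refine fun _ => ⟨innerSL ℝ c, ?_⟩
        rw [hF] at hz ⊢
        ext x
        simp only [Set.mem_inter_iff, Set.mem_ofPred_eq, innerSL_apply_apply, real_inner_comm _ c]
        refine and_congr_right fun hx => ⟨fun h y hy => (hle y hy).trans_eq h.symm, fun h => ?_⟩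
        exact (hle x hx).antisymm (hz.2.symm.trans_le (h z hz.1))
      have hsub : F.extremePoints ℝ ⊆ F ∩ S := fun x hx => ⟨hx.1, extremePoints_convexHull_subset
        (hexp.isExtreme.extremePoints_subset_extremePoints hx)⟩
      have hconv : Convex ℝ F := hexp.convex (convex_convexHull ℝ _)
      refine (convexHull_min Set.inter_subset_left hconv).antisymm' ?_
      rw [← closure_convexHull_extremePoints (hexp.isCompact hP) hconv]
      refine closure_minimal (convexHull_mono ?_)
        ((S.finite_toSet.inter_of_right _).isClosed_convexHull ℝ)
      rwa [closure_convexHull_extremePoints (hexp.isCompact hP) hconv]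
    intro F hF G hG hFG
    rw [key F hF, key G hG]
    exact congrArg _ hFG

lemma ncard_extremePoints_le_ncard_facets (hn : n ≠ 0)
    (S : Finset (EuclideanSpace ℝ (Fin n))) :
    ((polarBody S).extremePoints ℝ).Finite ∧ ((polarBody S).extremePoints ℝ).ncard ≤
      {F | IsFacetOf (convexHull ℝ (S : Set (EuclideanSpace ℝ (Fin n)))) F}.ncard := by
  have hmaps : Set.MapsTo
      (fun c => convexHull ℝ (S : Set (EuclideanSpace ℝ (Fin n))) ∩ {x | ⟪x, c⟫ = 1})
      ((polarBody S).extremePoints ℝ)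
      {F | IsFacetOf (convexHull ℝ (S : Set (EuclideanSpace ℝ (Fin n)))) F} :=
    fun c hc => isFacetOf_of_mem_extremePoints hn hc
  have hinj : Set.InjOn
      (fun c => convexHull ℝ (S : Set (EuclideanSpace ℝ (Fin n))) ∩ {x | ⟪x, c⟫ = 1})
      ((polarBody S).extremePoints ℝ) := by
    intro c hc d hd hcd
    have hle : Submodule.span ℝ {s | s ∈ S ∧ ⟪s, c⟫ = 1} ≤ (Submodule.span ℝ {c - d})ᗮ := by
      rw [Submodule.span_le]
      intro s hs
      have hmem := hcd.subset (show s ∈ _ ∩ _ from ⟨subset_convexHull ℝ _ hs.1, hs.2⟩)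
      rw [SetLike.mem_coe, Submodule.mem_orthogonal_singleton_iff_inner_left, inner_sub_right,
        hs.2, hmem.2, sub_self]
    rw [span_active_eq_top hc, top_le_iff] at hle
    have h : c - d ∈ (Submodule.span ℝ {c - d})ᗮ := hle ▸ Submodule.mem_top
    rw [Submodule.mem_orthogonal_singleton_iff_inner_left, inner_self_eq_zero] at h
    exact sub_eq_zero.1 h
  exact ⟨Set.Finite.of_injOn hmaps hinj (finite_setOf_isFacetOf S),
    Set.ncard_le_ncard_of_injOn _ hmaps hinj (finite_setOf_isFacetOf S)⟩

end Facets
section Sparse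

variable {E : Type*} [NormedAddCommGroup E] [InnerProductSpace ℝ E]

lemma span_eq_top_of_interior_convexHull_nonempty {V : Set E}
    (h : (interior (convexHull ℝ V)).Nonempty) : Submodule.span ℝ V = ⊤ :=
  Submodule.eq_top_of_nonempty_interior' _
    (h.mono (interior_mono (convexHull_min Submodule.subset_span (Submodule.span ℝ V).convex)))

variable [FiniteDimensional ℝ E]

/-- A finite spanning set contains a basis of maximal determinant. -/
lemma exists_basis_abs_det_le_one {n : ℕ} (hE : Module.finrank ℝ E = n) {V : Finset E}
    (hV : Submodule.span ℝ (V : Set E) = ⊤) :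
    ∃ b : Module.Basis (Fin n) ℝ E, (∀ i, b i ∈ V) ∧
      ∀ w : Fin n → E, (∀ i, w i ∈ V) → |b.det w| ≤ 1 := by
  let e := Module.finBasisOfFinrankEq ℝ E hE
  obtain ⟨f, hfV, hfspan, hfind⟩ := Submodule.exists_fun_fin_finrank_span_eq ℝ (V : Set E)
  have hcard : n = Module.finrank ℝ (Submodule.span ℝ (V : Set E)) := by
    rw [hV, finrank_top, hE]
  have hf : IsUnit (e.det (f ∘ finCongr hcard)) := by
    rw [← e.is_basis_iff_det, (finCongr hcard).surjective.range_comp, hfspan]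
    exact ⟨hfind.comp _ (finCongr hcard).injective, hV⟩
  have : Nonempty (Fin n → V) := ⟨fun i => ⟨f (finCongr hcard i), hfV _⟩⟩
  obtain ⟨w₀, hw₀⟩ := Finite.exists_max fun w : Fin n → V => |e.det fun i => (w i : E)|
  have hpos : 0 < |e.det fun i => (w₀ i : E)| :=
    (abs_pos.2 hf.ne_zero).trans_le (hw₀ fun i => ⟨f (finCongr hcard i), hfV _⟩)
  obtain ⟨hli, hsp⟩ := e.is_basis_iff_det.2 (abs_pos.1 hpos).isUnit
  have hb : ∀ i, Module.Basis.mk hli hsp.ge i = w₀ i := fun i => by simp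
  refine ⟨Module.Basis.mk hli hsp.ge, fun i => by simp, fun w hw => ?_⟩
  have hmul : e.det (fun i => (w₀ i : E)) * (Module.Basis.mk hli hsp.ge).det w = e.det w := by
    set b := Module.Basis.mk hli hsp.ge
    have hw' : w = b.constr ℝ w ∘ b := funext fun i => (b.constr_basis ℝ w i).symm
    rw [hw', e.det_comp, b.det_comp, b.det_self, mul_one, mul_comm]
    exact congrArg _ (congrArg _ (funext fun i => (hb i).symm))
  have hmax := hw₀ fun i => ⟨w i, hw i⟩
  simp only [← hmul, abs_mul] at hmax
  exact le_of_mul_le_mul_left (by simpa using hmax) hpos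

/-- Every point of a polytope with interior point `0` is a combination of at most `dim E` of its
vertices, with absolute coefficient sum at most one. -/
lemma exists_sparse_representation {n : ℕ} (hE : Module.finrank ℝ E = n) {V : Finset E}
    (h0 : (0 : E) ∈ interior (convexHull ℝ (V : Set E)))
    (hfin : ((polarBody V).extremePoints ℝ).Finite) {x : E}
    (hx : x ∈ convexHull ℝ (V : Set E)) :
    ∃ T ∈ V.powersetCard n, ∃ h : E → ℝ, ∑ v ∈ T, |h v| ≤ 1 ∧ ∑ v ∈ T, h v • v = x := by
  classical
  have hspan := span_eq_top_of_interior_convexHull_nonempty ⟨0, h0⟩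
  have hVcard : n ≤ V.card := by
    have := finrank_span_finset_le_card (R := ℝ) V
    rwa [Set.finrank, hspan, finrank_top, hE] at this
  have hP := V.finite_toSet.isCompact_convexHull ℝ
  suffices ∃ T ⊆ V, T.card ≤ n ∧ ∃ h : E → ℝ, ∑ v ∈ T, |h v| ≤ 1 ∧ ∑ v ∈ T, h v • v = x by
    obtain ⟨T, hTV, hTn, h, h1, h2⟩ := this
    obtain ⟨U, hTU, hUV, hU⟩ := Finset.exists_subsuperset_card_eq hTV hTn hVcard
    refine ⟨U, Finset.mem_powersetCard.2 ⟨hUV, hU⟩, fun v => if v ∈ T then h v else 0, ?_, ?_⟩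
    · simpa [apply_ite abs, Finset.sum_ite_mem, Finset.inter_eq_right.2 hTU] using h1
    · simpa [ite_smul, Finset.sum_ite_mem, Finset.inter_eq_right.2 hTU] using h2
  rcases eq_or_ne x 0 with rfl | hx0
  · exact ⟨∅, by simp, by simp, 0, by simp, by simp⟩
  have hpos : ∃ c ∈ (polarBody V).extremePoints ℝ, 0 < ⟪x, c⟫ := by
    obtain ⟨R, hR⟩ := isBounded_iff_forall_norm_le.1 hP.isBounded
    have hR0 : 0 ≤ R := (norm_nonneg x).trans (hR x hx)
    have hxn : 0 < ‖x‖ := norm_pos_iff.2 hx0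
    have hout : ((R + 1) / ‖x‖) • x ∉ convexHull ℝ (V : Set E) := fun hmem => by
      have := hR _ hmem
      rw [norm_smul, Real.norm_of_nonneg (by positivity), div_mul_cancel₀ _ hxn.ne'] at this
      linarith
    obtain ⟨c, hc, hlt⟩ := exists_extremePoint_polarBody_one_lt_inner h0 hout
    rw [real_inner_smul_left] at hlt
    exact ⟨c, hc, pos_of_mul_pos_right (one_pos.trans hlt) (by positivity)⟩
  obtain ⟨c₁, hc₁, hc₁pos⟩ := hpos
  obtain ⟨c₀, hc₀, hmax⟩ := Set.exists_max_image _ (fun c => ⟪x, c⟫) hfin ⟨c₁, hc₁⟩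
  set r := ⟪x, c₀⟫ with hr
  have hr0 : 0 < r := hc₁pos.trans_le (hmax c₁ hc₁)
  have hr1 : r ≤ 1 := inner_le_of_mem_convexHull hc₀.1 hx
  have hy : r⁻¹ • x ∈ convexHull ℝ (V : Set E) := by
    by_contra hout
    obtain ⟨c, hc, hlt⟩ := exists_extremePoint_polarBody_one_lt_inner h0 hout
    rw [real_inner_smul_left, lt_inv_mul_iff₀ hr0, mul_one] at hlt
    exact hlt.not_ge (hmax c hc)
  obtain ⟨ι, _, z, l, hzV, hz, hl, hl1, hsum⟩ := eq_pos_convex_span_of_mem_convexHull hy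
  have hle : ∀ i, ⟪z i, c₀⟫ ≤ 1 := fun i => hc₀.1 _ (hzV ⟨i, rfl⟩)
  have hone : ∀ i, ⟪z i, c₀⟫ = 1 := by
    have hzero : ∑ i, l i * (1 - ⟪z i, c₀⟫) = 0 := by
      have h : ∑ i, l i * ⟪z i, c₀⟫ = 1 := by
        simp_rw [← real_inner_smul_left]
        rw [← sum_inner, hsum, real_inner_smul_left, ← hr, inv_mul_cancel₀ hr0.ne']
      simp [mul_sub, Finset.sum_sub_distrib, h, hl1]
    rw [Finset.sum_eq_zero_iff_of_nonneg fun i _ =>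
      mul_nonneg (hl i).le (sub_nonneg.2 (hle i))] at hzero
    intro i
    have := (mul_eq_zero.1 (hzero i (Finset.mem_univ i))).resolve_left (hl i).ne'
    linarith
  have hzind : LinearIndependent ℝ z := by
    rw [linearIndependent_iff']
    intro s a ha
    refine affineIndependent_iff.1 hz s a ?_ ha
    have := congrArg (fun y => ⟪y, c₀⟫) ha
    simpa [sum_inner, real_inner_smul_left, hone] using this
  refine ⟨Finset.univ.image z, ?_, ?_, fun v => ∑ i, if z i = v then r * l i else 0, ?_, ?_⟩
  · simpa [Finset.subset_iff, Set.range_subset_iff] using hzV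
  · exact Finset.card_image_le.trans (hzind.fintype_card_le_finrank.trans_eq hE)
  · have habs : ∀ v, |∑ i, if z i = v then r * l i else 0| =
        ∑ i, if z i = v then r * l i else 0 := fun v =>
      abs_of_nonneg (Finset.sum_nonneg fun i _ => by
        split_ifs
        exacts [mul_nonneg hr0.le (hl i).le, le_rfl])
    simp_rw [habs]
    rw [Finset.sum_comm]
    simpa [← Finset.mul_sum, hl1] using hr1
  · simp_rw [Finset.sum_smul]
    rw [Finset.sum_comm]
    simp only [ite_smul, zero_smul, Finset.sum_ite_eq, Finset.mem_image_of_mem, Finset.mem_univ,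
      if_true, mul_smul]
    rw [← Finset.smul_sum, hsum, smul_inv_smul₀ hr0.ne']

/-- The volume, in coordinates of a basis of maximal determinant, of a polytope with few
vertices dilated by its dimension. -/
lemma volume_dilate_le {n : ℕ} (hn : n ≠ 0) (hE : Module.finrank ℝ E = n) {V : Finset E}
    (h0 : (0 : E) ∈ interior (convexHull ℝ (V : Set E)))
    (hfin : ((polarBody V).extremePoints ℝ).Finite) (b : Module.Basis (Fin n) ℝ E)
    (hb : ∀ w : Fin n → E, (∀ i, w i ∈ V) → |b.det w| ≤ 1) :
    volume {g : Fin n → ℝ | (n : ℝ)⁻¹ • ∑ i, g i • b i ∈ convexHull ℝ (V : Set E)} ≤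
      ENNReal.ofReal (2 ^ V.card * (2 * Real.exp 1) ^ n) := by
  have hn0 : (n : ℝ) ≠ 0 := Nat.cast_ne_zero.2 hn
  have hmap : ∀ T ∈ V.powersetCard n, ∃ f : (Fin n → ℝ) →ₗ[ℝ] Fin n → ℝ,
      |LinearMap.det f| ≤ 1 ∧ ∀ (g : Fin n → ℝ) (h : E → ℝ), ∑ v ∈ T, |h v| ≤ 1 →
        ∑ v ∈ T, h v • v = (n : ℝ)⁻¹ • ∑ i, g i • b i → g ∈ f '' {x | ∑ i, |x i| ≤ n} := by
    intro T hT
    obtain ⟨hTV, hTn⟩ := Finset.mem_powersetCard.1 hT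
    let e := (Finset.equivFinOfCardEq hTn).symm
    let w : Fin n → E := fun i => e i
    refine ⟨b.equivFun ∘ₗ b.constr ℝ w ∘ₗ b.equivFun.symm, ?_, fun g h h1 h2 => ?_⟩
    · have hdet : LinearMap.det (b.constr ℝ w) = b.det w := by
        have hw' : w = b.constr ℝ w ∘ b := funext fun i => (b.constr_basis ℝ w i).symm
        conv_rhs => rw [hw', b.det_comp, b.det_self, mul_one]
      rw [LinearMap.det_conj, hdet]
      exact hb w fun i => hTV (e i).2
    · rw [← Finset.sum_coe_sort, ← e.sum_comp] at h1 h2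
      refine ⟨fun i => n * h (w i), ?_, ?_⟩
      · simp only [Set.mem_ofPred_eq, abs_mul, Nat.abs_cast, ← Finset.mul_sum]
        exact mul_le_of_le_one_right n.cast_nonneg h1
      · have hg : b.equivFun.symm g = (n : ℝ) • ∑ i, h (w i) • w i := by
          rw [h2, smul_inv_smul₀ hn0, b.equivFun_symm_apply]
        rw [← b.equivFun.apply_symm_apply g, hg]
        simp [Module.Basis.constr_apply_fintype, mul_smul, Finset.smul_sum]
  choose! f hf hcover using hmap
  have hsub : {g : Fin n → ℝ | (n : ℝ)⁻¹ • ∑ i, g i • b i ∈ convexHull ℝ (V : Set E)} ⊆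
      ⋃ T ∈ V.powersetCard n, f T '' {x | ∑ i, |x i| ≤ n} := by
    intro g hg
    obtain ⟨T, hT, h, h1, h2⟩ := exists_sparse_representation hE h0 hfin hg
    exact Set.mem_biUnion hT (hcover T hT g h h1 h2)
  calc _ ≤ volume (⋃ T ∈ V.powersetCard n, f T '' {x | ∑ i, |x i| ≤ n}) := measure_mono hsub
    _ ≤ ∑ T ∈ V.powersetCard n, volume (f T '' {x | ∑ i, |x i| ≤ n}) :=
        measure_biUnion_finset_le _ _
    _ ≤ ∑ T ∈ V.powersetCard n, ENNReal.ofReal ((2 * Real.exp 1) ^ n) :=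
        Finset.sum_le_sum fun T hT => volume_image_l1Ball_le hn _ (hf T hT)
    _ = ENNReal.ofReal (V.card.choose n * (2 * Real.exp 1) ^ n) := by
        rw [Finset.sum_const, Finset.card_powersetCard, nsmul_eq_mul,
          ENNReal.ofReal_mul (Nat.cast_nonneg _), ENNReal.ofReal_natCast]
    _ ≤ _ := by
        refine ENNReal.ofReal_le_ofReal ?_
        gcongr
        exact_mod_cast Nat.choose_le_two_pow _ _

end Sparse

section Count

variable {E : Type*} [NormedAddCommGroup E] [InnerProductSpace ℝ E] [FiniteDimensional ℝ E]

lemma two_le_ncard_extremePoints_polarBody [Nontrivial E] {V : Finset E}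
    (h0 : (0 : E) ∈ interior (convexHull ℝ (V : Set E)))
    (hsymm : convexHull ℝ (V : Set E) = -convexHull ℝ (V : Set E))
    (hfin : ((polarBody V).extremePoints ℝ).Finite) :
    2 ≤ ((polarBody V).extremePoints ℝ).ncard := by
  obtain ⟨c, hc⟩ := (isCompact_polarBody h0).extremePoints_nonempty ⟨0, by simp [polarBody]⟩
  have hc0 : c ≠ 0 := by
    rintro rfl
    have := span_active_eq_top hc
    simp at this
  have hpos : 0 < ⟪c, c⟫ := real_inner_self_pos.2 hc0
  have hout : (-(2 / ⟪c, c⟫)) • c ∉ convexHull ℝ (V : Set E) := by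
    rw [hsymm, Set.mem_neg, neg_smul, neg_neg]
    intro hmem
    have := inner_le_of_mem_convexHull hc.1 hmem
    rw [real_inner_smul_left, div_mul_cancel₀ _ hpos.ne'] at this
    norm_num at this
  obtain ⟨d, hd, hlt⟩ := exists_extremePoint_polarBody_one_lt_inner h0 hout
  refine (Set.one_lt_ncard hfin).2 ⟨c, hc, d, hd, ?_⟩
  rintro rfl
  rw [real_inner_smul_left, neg_mul, div_mul_cancel₀ _ hpos.ne'] at hlt
  norm_num at hlt

/-- A cube of suitable size is covered by a dilate of the polytope, which is small, and by the
half-spaces cut off by the facets of that dilate, each of which is exponentially small. -/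
lemma cube_covering_inequality {n : ℕ} (hn : n ≠ 0) (hE : Module.finrank ℝ E = n) {V : Finset E}
    (h0 : (0 : E) ∈ interior (convexHull ℝ (V : Set E)))
    (hsymm : convexHull ℝ (V : Set E) = -convexHull ℝ (V : Set E))
    (hfin : ((polarBody V).extremePoints ℝ).Finite) {K : ℝ} (hK : 0 < K) :
    (2 * K) ^ n ≤ 2 ^ V.card * (2 * Real.exp 1) ^ n +
      ((polarBody V).extremePoints ℝ).ncard * ((2 * K) ^ n * Real.exp (-(n / (2 * K ^ 2)))) := by
  have hn0 : (0 : ℝ) < n := Nat.cast_pos.2 (Nat.pos_of_ne_zero hn)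
  obtain ⟨b, hbV, hb⟩ := exists_basis_abs_det_le_one hE
    (span_eq_top_of_interior_convexHull_nonempty ⟨0, h0⟩)
  set μ := volume.restrict (Set.univ.pi fun _ : Fin n => Set.Icc (-K) K) with hμ
  set D := {g : Fin n → ℝ | (n : ℝ)⁻¹ • ∑ i, g i • b i ∈ convexHull ℝ (V : Set E)} with hD
  have hvol : volume (Set.univ.pi fun _ : Fin n => Set.Icc (-K) K) =
      ENNReal.ofReal ((2 * K) ^ n) := by
    rw [volume_pi_pi]
    simp only [Real.volume_Icc, Finset.prod_const, Finset.card_univ, Fintype.card_fin]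
    rw [ENNReal.ofReal_pow (by positivity)]
    congr 2
    ring
  have : IsFiniteMeasure μ := ⟨by
    rw [hμ, Measure.restrict_apply_univ, hvol]
    exact ENNReal.ofReal_lt_top⟩
  have huniv : μ.real Set.univ = (2 * K) ^ n := by
    rw [measureReal_def, hμ, Measure.restrict_apply_univ, hvol,
      ENNReal.toReal_ofReal (by positivity)]
  have hDle : μ.real D ≤ 2 ^ V.card * (2 * Real.exp 1) ^ n :=
    ENNReal.toReal_le_of_le_ofReal (by positivity)
      ((Measure.restrict_apply_le _ _).trans (volume_dilate_le hn hE h0 hfin b hb))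
  have hcoef : ∀ c ∈ (polarBody V).extremePoints ℝ, ∀ i, |⟪b i, c⟫| ≤ 1 := by
    intro c hc i
    have hmem : -b i ∈ convexHull ℝ (V : Set E) := by
      rw [hsymm, Set.neg_mem_neg]
      exact subset_convexHull ℝ _ (hbV i)
    have := inner_le_of_mem_convexHull hc.1 hmem
    rw [inner_neg_left] at this
    exact abs_le.2 ⟨by linarith, hc.1 _ (hbV i)⟩
  have hcover : Set.univ ⊆ D ∪ ⋃ c ∈ hfin.toFinset,
      {g : Fin n → ℝ | (n : ℝ) ≤ ∑ i, ⟪b i, c⟫ * g i} := by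
    intro g _
    by_cases hg : g ∈ D
    · exact Or.inl hg
    · obtain ⟨c, hc, hlt⟩ := exists_extremePoint_polarBody_one_lt_inner h0 hg
      refine Or.inr (Set.mem_biUnion (hfin.mem_toFinset.2 hc) ?_)
      rw [real_inner_smul_left, lt_inv_mul_iff₀ hn0, mul_one, sum_inner] at hlt
      simp only [real_inner_smul_left] at hlt
      simpa only [Set.mem_ofPred_eq, mul_comm] using hlt.le
  calc (2 * K) ^ n = μ.real Set.univ := huniv.symm
    _ ≤ _ := measureReal_mono hcover
    _ ≤ _ := measureReal_union_le _ _
    _ ≤ μ.real D + ∑ c ∈ hfin.toFinset, μ.real {g : Fin n → ℝ | (n : ℝ) ≤ ∑ i, ⟪b i, c⟫ * g i} := by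
        gcongr
        exact measureReal_biUnion_finset_le _ _
    _ ≤ 2 ^ V.card * (2 * Real.exp 1) ^ n +
        ∑ c ∈ hfin.toFinset, (2 * K) ^ n * Real.exp (-(n / (2 * K ^ 2))) := by
        gcongr with c hc
        exact measureReal_cube_linear_ge_le hK (hcoef c (hfin.mem_toFinset.1 hc))
    _ = _ := by
        rw [Finset.sum_const, nsmul_eq_mul, Set.ncard_eq_toFinset_card _ hfin]

end Count

lemma exp_le_of_covering_inequality {n : ℕ} (hn : n ≠ 0) {K N : ℝ} (hK : 0 < K) (hN : 2 ≤ N)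
    (h : (2 * K) ^ n ≤ K ^ n + N * ((2 * K) ^ n * Real.exp (-(n / (2 * K ^ 2))))) :
    Real.exp (n / (4 * K ^ 2)) ≤ N := by
  set t := Real.exp (n / (4 * K ^ 2)) with ht
  have ht0 : 0 < t := Real.exp_pos _
  have hexp : Real.exp (-(n / (2 * K ^ 2))) = (t ^ 2)⁻¹ := by
    rw [ht, ← Real.exp_nat_mul, ← Real.exp_neg]
    congr 2
    push_cast
    field_simp
    ring
  have htwo : (2 : ℝ) ≤ 2 ^ n := le_self_pow₀ one_le_two hn
  rw [hexp, mul_pow] at h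
  have hKn : 0 < K ^ n := by positivity
  have h1 : (2 : ℝ) ^ n ≤ 1 + N * (2 ^ n * (t ^ 2)⁻¹) := by
    refine le_of_mul_le_mul_right ?_ hKn
    calc _ ≤ _ := h
      _ = _ := by ring
  have h2 : t ^ 2 * 2 ^ n ≤ t ^ 2 + N * 2 ^ n := by
    calc t ^ 2 * 2 ^ n ≤ t ^ 2 * (1 + N * (2 ^ n * (t ^ 2)⁻¹)) := by gcongr
      _ = _ := by field_simp
  have h3 : t ^ 2 ≤ 2 * N := by
    by_contra! hlt
    nlinarith
  exact abs_le_of_sq_le_sq' (by nlinarith) (by linarith) |>.2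

/-- Dual form of Corollary 1.2: for every `α ≥ 1` there is `γ > 0` such that every
`n`-dimensional centrally symmetric polytope with at most `αn` vertices (extreme points)
has at least `2^{γn}` facets. -/
theorem stmt_3 (α : ℝ) (hα : 1 ≤ α) :
    ∃ γ > (0 : ℝ), ∀ (n : ℕ) (S : Finset (EuclideanSpace ℝ (Fin n))),
      (interior (convexHull ℝ (S : Set (EuclideanSpace ℝ (Fin n))))).Nonempty →
      convexHull ℝ (S : Set (EuclideanSpace ℝ (Fin n))) =
        -convexHull ℝ (S : Set (EuclideanSpace ℝ (Fin n))) →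
      (((Set.extremePoints ℝ
          (convexHull ℝ (S : Set (EuclideanSpace ℝ (Fin n))))).ncard : ℝ) ≤ α * n) →
      (2 : ℝ) ^ (γ * n) ≤
        ({F | IsFacetOf (convexHull ℝ (S : Set (EuclideanSpace ℝ (Fin n)))) F}.ncard : ℝ) := by
  set K : ℝ := 2 ^ α * (2 * Real.exp 1) with hK
  have hK0 : 0 < K := by positivity
  have hlog : 0 < Real.log 2 := Real.log_pos one_lt_two
  refine ⟨1 / (4 * K ^ 2 * Real.log 2), by positivity, fun n S hint hsymm hcard => ?_⟩
  have hP := S.finite_toSet.isCompact_convexHull ℝ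
  have hVfin : (Set.extremePoints ℝ
      (convexHull ℝ (S : Set (EuclideanSpace ℝ (Fin n))))).Finite :=
    S.finite_toSet.subset extremePoints_convexHull_subset
  have hV : convexHull ℝ (hVfin.toFinset : Set (EuclideanSpace ℝ (Fin n))) =
      convexHull ℝ (S : Set (EuclideanSpace ℝ (Fin n))) := by
    rw [hVfin.coe_toFinset, ← (hVfin.isClosed_convexHull ℝ).closure_eq]
    exact closure_convexHull_extremePoints hP (convex_convexHull ℝ _)
  rw [Set.ncard_eq_toFinset_card _ hVfin] at hcard
  rw [← hV] at hint hsymm ⊢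
  set V := hVfin.toFinset
  have hn : n ≠ 0 := by
    rintro rfl
    have hV0 : V = ∅ := by
      rw [← Finset.card_eq_zero]
      exact_mod_cast (hcard.trans_eq (by simp)).antisymm (Nat.cast_nonneg _)
    simp [hV0] at hint
  have hE : Module.finrank ℝ (EuclideanSpace ℝ (Fin n)) = n := by simp
  have : Nontrivial (EuclideanSpace ℝ (Fin n)) :=
    Module.nontrivial_of_finrank_pos (R := ℝ) (by rw [hE]; exact Nat.pos_of_ne_zero hn)
  have h0 : (0 : EuclideanSpace ℝ (Fin n)) ∈ interior (convexHull ℝ (V : Set _)) := by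
    obtain ⟨x, hx⟩ := hint
    have hx' : -x ∈ interior (convexHull ℝ (V : Set (EuclideanSpace ℝ (Fin n)))) := by
      rw [hsymm]
      exact ((Homeomorph.neg _).preimage_interior _).subset (by simpa using hx)
    have := (convex_convexHull ℝ _).interior hx hx' (a := 1 / 2) (b := 1 / 2) (by norm_num)
      (by norm_num) (by norm_num)
    simpa using this
  obtain ⟨hfin, hle⟩ := ncard_extremePoints_le_ncard_facets hn V
  have htwo : (2 : ℝ) ≤ ((polarBody V).extremePoints ℝ).ncard := by
    exact_mod_cast two_le_ncard_extremePoints_polarBody h0 hsymm hfin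
  have hsize : (2 : ℝ) ^ V.card * (2 * Real.exp 1) ^ n ≤ K ^ n := by
    rw [hK, mul_pow (2 ^ α), ← Real.rpow_natCast 2 V.card, ← Real.rpow_mul_natCast zero_le_two]
    gcongr
    exact one_le_two
  have hcov := (cube_covering_inequality hn hE h0 hsymm hfin hK0).trans
    (add_le_add_left hsize _)
  calc (2 : ℝ) ^ (1 / (4 * K ^ 2 * Real.log 2) * n) = Real.exp (n / (4 * K ^ 2)) := by
        rw [Real.rpow_def_of_pos two_pos]
        congr 1
        field_simp
    _ ≤ ((polarBody V).extremePoints ℝ).ncard := exp_le_of_covering_inequality hn hK0 htwo hcov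
    _ ≤ _ := by exact_mod_cast hle
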